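/- (Adiabatic Theorem.) Let n ≥ 1 and let H : [0,1] → Herm(ℂⁿ) be a twice continuously differentiable family of Hermitian matrices. Suppose the spectral projection P(s) onto the eigenspace of the lowest eigenvalue E(s) of H(s) has constant rank, and that the gap between E(s) and the rest of the spectrum of H(s) is bounded below by some γ₀ > 0 uniformly in s ∈ [0,1]. Then there exists a constant C such that for every τ > 0 and every solution ψ_τ : [0,1] → ℂⁿ of i ψ_τ′(s) = τ H(s) ψ_τ(s) with ψ_τ(0) ∈ ran P(0) and ‖ψ_τ(0)‖ = 1, one has sup_{s∈[0,1]} ‖(1 − P(s)) ψ_τ(s)‖ ≤ C/τ. -/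

import Mathlib

open Matrix

noncomputable section

/-- The set of (real) eigenvalues of a matrix. -/
def eigSet {n : Type*} [Fintype n] [DecidableEq n] (H : Matrix n n ℂ) : Set ℝ :=
  {μ : ℝ | ∃ ψ : n → ℂ, ψ ≠ 0 ∧ H.mulVec ψ = (μ : ℂ) • ψ}

/-- ℓ²-norm of a vector in `ℂⁿ`. -/
def vnorm {n : ℕ} (v : Fin n → ℂ) : ℝ := Real.sqrt ((star v ⬝ᵥ v).re)

open scoped Topology InnerProductSpace ComplexOrder
open Set Filter Asymptotics

theorem HasDerivWithinAt.mul_mul_of_eq_zero {A : Type*} [NormedRing A] [NormedAlgebra ℝ A]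
    {a b c : ℝ → A} {b' : A} {S : Set ℝ} {s : ℝ} (ha : ContinuousWithinAt a S s)
    (hb : HasDerivWithinAt b b' S s) (hb0 : b s = 0) (hc : ContinuousWithinAt c S s) :
    HasDerivWithinAt (fun t => a t * b t * c t) (a s * b' * c s) S s := by
  rw [hasDerivWithinAt_iff_tendsto_slope] at hb ⊢
  have hmono : 𝓝[S \ {s}] s ≤ 𝓝[S] s := nhdsWithin_mono _ sdiff_subset
  refine (((ha.tendsto.mono_left hmono).mul hb).mul (hc.tendsto.mono_left hmono)).congr ?_
  intro t
  simp [slope, hb0]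

/-- `r` is the reduced resolvent of `h` at the eigenvalue `e` with spectral projection `p`. -/
structure IsReducedResolvent {A : Type*} [Ring A] [Algebra ℝ A] (h p r : A) (e : ℝ) : Prop where
  idem : p * p = p
  mul_proj : h * p = e • p
  proj_mul : p * h = e • p
  resolvent_proj : r * p = 0
  proj_resolvent : p * r = 0
  resolvent_mul : r * h = e • r + 1 - p
  mul_resolvent : h * r = e • r + 1 - p

namespace IsReducedResolvent

section Algebra

variable {A : Type*} [Ring A] [Algebra ℝ A] {h p r h₁ p₁ r₁ : A} {e e₁ : ℝ}

theorem proj_sub (I : IsReducedResolvent h p r e) (I₁ : IsReducedResolvent h₁ p₁ r₁ e₁) :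
    p₁ - p = r * (h - h₁ + (e₁ - e) • 1) * p₁ + p * (h - h₁ + (e₁ - e) • 1) * r₁ := by
  have e1 : r * (h - h₁ + (e₁ - e) • 1) * p₁ = p₁ - p * p₁ := by
    calc _ = r * h * p₁ - r * (h₁ * p₁) + (e₁ - e) • (r * p₁) := by
          simp only [mul_add, add_mul, mul_sub, sub_mul, mul_smul_comm, smul_mul_assoc, mul_one,
            mul_assoc]
      _ = _ := by
          rw [I.resolvent_mul, I₁.mul_proj]
          simp only [add_mul, sub_mul, mul_smul_comm, smul_mul_assoc, one_mul]
          module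
  have e2 : p * (h - h₁ + (e₁ - e) • 1) * r₁ = p * p₁ - p := by
    calc _ = p * h * r₁ - p * (h₁ * r₁) + (e₁ - e) • (p * r₁) := by
          simp only [mul_add, add_mul, mul_sub, sub_mul, mul_smul_comm, smul_mul_assoc, mul_one,
            mul_assoc]
      _ = _ := by
          rw [I.proj_mul, I₁.mul_resolvent]
          simp only [mul_add, mul_sub, mul_smul_comm, smul_mul_assoc, mul_one]
          module
  rw [e1, e2]
  abel

theorem mul_shift (I : IsReducedResolvent h p r e) : (r + p) * (h - e • 1 + p) = 1 := by
  simp only [mul_add, add_mul, mul_sub, mul_smul_comm, mul_one,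
    I.resolvent_mul, I.proj_mul, I.resolvent_proj, I.idem]
  module

theorem shift_mul (I : IsReducedResolvent h p r e) : (h - e • 1 + p) * (r + p) = 1 := by
  simp only [mul_add, add_mul, sub_mul, smul_mul_assoc, one_mul,
    I.mul_resolvent, I.mul_proj, I.proj_resolvent, I.idem]
  module

theorem resolvent_sub (I : IsReducedResolvent h p r e) (I₁ : IsReducedResolvent h₁ p₁ r₁ e₁) :
    r₁ - r = (r₁ + p₁) * ((h - h₁ + (e₁ - e) • 1) + (p - p₁)) * (r + p) + (p - p₁) := by
  have key : (r₁ + p₁) * ((h - e • 1 + p) - (h₁ - e₁ • 1 + p₁)) * (r + p)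
      = (r₁ + p₁) - (r + p) := by
    rw [mul_sub, sub_mul, I₁.mul_shift, mul_assoc, I.shift_mul, mul_one, one_mul]
  have : (h - h₁ + (e₁ - e) • (1 : A)) + (p - p₁) = (h - e • 1 + p) - (h₁ - e₁ • 1 + p₁) := by
    module
  rw [this, key]
  abel

/-- The off-diagonal generator `x = r²dp - pdr²` solves `[h, x] = rdp + pdr`. -/
theorem commutator (I : IsReducedResolvent h p r e) (d : A) :
    h * (r * r * d * p - p * d * r * r) - (r * r * d * p - p * d * r * r) * h
      = r * d * p + p * d * r := by
  have a1 : h * (r * r * d * p) = (h * r) * r * d * p := by simp only [mul_assoc]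
  have a2 : h * (p * d * r * r) = (h * p) * d * r * r := by simp only [mul_assoc]
  have a3 : r * r * d * p * h = r * r * d * (p * h) := by simp only [mul_assoc]
  have a4 : p * d * r * r * h = p * d * r * (r * h) := by simp only [mul_assoc]
  have a5 : p * d * r * p = 0 := by rw [mul_assoc, I.resolvent_proj, mul_zero]
  rw [mul_sub, sub_mul, a1, a2, a3, a4, I.mul_resolvent, I.mul_proj, I.proj_mul, I.resolvent_mul]
  simp only [mul_add, add_mul, mul_sub, sub_mul, smul_mul_assoc, mul_smul_comm, one_mul, mul_one,
    I.proj_resolvent, a5, zero_mul]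
  module

theorem proj_mul_generator_mul_proj (I : IsReducedResolvent h p r e) (d : A) :
    p * (r * r * d * p - p * d * r * r) * p = 0 := by
  have a1 : p * (r * r * d * p) = 0 := by simp only [← mul_assoc, I.proj_resolvent, zero_mul]
  have a2 : p * d * r * r * p = 0 := by rw [mul_assoc, I.resolvent_proj, mul_zero]
  rw [mul_sub, a1, zero_sub, neg_mul, mul_assoc p, a2, mul_zero, neg_zero]

/-- The derivative of the generator has no diagonal block on the range of `p`, for
any derivatives `p'`, `r'` compatible with the defining relations. -/
theorem proj_mul_deriv_generator_mul_proj (I : IsReducedResolvent h p r e) {d d' p' r' : A}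
    (hp' : p' = -(r * d * p + p * d * r)) (h1 : p' * r + p * r' = 0) (h2 : r' * p + r * p' = 0) :
    p * ((((r' * r + r * r') * d + r * r * d') * p + r * r * d * p')
      - (((p' * d + p * d') * r + p * d * r') * r + p * d * r * r')) * p = 0 := by
  have pr : ∀ x, p * (r * x) = 0 := fun x => by rw [← mul_assoc, I.proj_resolvent, zero_mul]
  have pp : ∀ x, p * (p * x) = p * x := fun x => by rw [← mul_assoc, I.idem]
  have pr' : ∀ x, p * (r' * x) = -(p' * (r * x)) := fun x => by
    rw [← mul_assoc, eq_neg_of_add_eq_zero_right h1, neg_mul, mul_assoc]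
  have r'p : r' * p = -(r * p') := eq_neg_of_add_eq_zero_left h2
  have rp : ∀ x, r * (p * x) = 0 := fun x => by rw [← mul_assoc, I.resolvent_proj, zero_mul]
  simp only [mul_add, add_mul, mul_sub, sub_mul, mul_assoc, pr, pp, pr', r'p,
    I.resolvent_proj, mul_zero, mul_neg]
  subst hp'
  simp only [mul_add, add_mul, mul_neg, neg_mul, mul_assoc, pr, rp, I.idem,
    mul_zero]
  simp

end Algebra

section Deriv

variable {A : Type*} [NormedRing A] [NormedAlgebra ℝ A] {H P R : ℝ → A} {E : ℝ → ℝ}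
  {S : Set ℝ} {s : ℝ} {d : A} {e' : ℝ}

theorem hasDerivWithinAt_proj (hI : ∀ t ∈ S, IsReducedResolvent (H t) (P t) (R t) (E t))
    (hs : s ∈ S) (hH : HasDerivWithinAt H d S s) (hE : HasDerivWithinAt E e' S s)
    (hP : ContinuousWithinAt P S s) (hR : ContinuousWithinAt R S s) :
    HasDerivWithinAt P (-(R s * d * P s + P s * d * R s)) S s := by
  have hB : HasDerivWithinAt (fun t => H s - H t + (E t - E s) • (1 : A)) (-d + e' • 1) S s :=
    (hH.const_sub _).add ((hE.sub_const _).smul_const _)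
  have h1 := HasDerivWithinAt.mul_mul_of_eq_zero (a := fun _ => R s) continuousWithinAt_const hB
    (by simp) hP
  have h2 := HasDerivWithinAt.mul_mul_of_eq_zero (a := fun _ => P s) continuousWithinAt_const hB
    (by simp) hR
  have h3 := ((h1.add h2).const_add (P s))
  refine (h3.congr (fun t ht => ?_) ?_).congr_deriv ?_
  · rw [← sub_eq_iff_eq_add', (hI s hs).proj_sub (hI t ht)]; rfl
  · rw [← sub_eq_iff_eq_add', (hI s hs).proj_sub (hI s hs)]; rfl
  · simp only [mul_add, add_mul, mul_neg, neg_mul, mul_smul_comm, smul_mul_assoc, mul_one,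
      (hI s hs).resolvent_proj, (hI s hs).proj_resolvent]
    module

theorem hasDerivWithinAt_resolvent (hI : ∀ t ∈ S, IsReducedResolvent (H t) (P t) (R t) (E t))
    (hs : s ∈ S) (hH : HasDerivWithinAt H d S s) (hE : HasDerivWithinAt E e' S s)
    {p' : A} (hP : HasDerivWithinAt P p' S s) (hR : ContinuousWithinAt R S s) :
    HasDerivWithinAt R ((R s + P s) * (-d + e' • 1 - p') * (R s + P s) - p') S s := by
  have hB : HasDerivWithinAt (fun t => H s - H t + (E t - E s) • (1 : A) + (P s - P t))
      (-d + e' • 1 + -p') S s :=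
    ((hH.const_sub _).add ((hE.sub_const _).smul_const _)).add (hP.const_sub _)
  have h1 := HasDerivWithinAt.mul_mul_of_eq_zero (c := fun _ => R s + P s)
    (hR.add hP.continuousWithinAt) hB (by simp) continuousWithinAt_const
  have h3 := ((h1.add (hP.const_sub (P s))).const_add (R s))
  refine (h3.congr (fun t ht => ?_) ?_).congr_deriv ?_
  · rw [← sub_eq_iff_eq_add', (hI s hs).resolvent_sub (hI t ht)]; rfl
  · rw [← sub_eq_iff_eq_add', (hI s hs).resolvent_sub (hI s hs)]; rfl
  · simp only [← sub_eq_add_neg]; rfl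

theorem exists_generator (hI : ∀ t ∈ S, IsReducedResolvent (H t) (P t) (R t) (E t))
    (hS : IsCompact S) (hSu : UniqueDiffOn ℝ S) {D D' : ℝ → A} {E' : ℝ → ℝ}
    (hH : ∀ s ∈ S, HasDerivWithinAt H (D s) S s) (hD : ∀ s ∈ S, HasDerivWithinAt D (D' s) S s)
    (hD' : ContinuousOn D' S) (hE : ∀ s ∈ S, HasDerivWithinAt E (E' s) S s)
    (hE' : ∀ s ∈ S, ‖E' s‖ ≤ ‖D s‖) (hP : ContinuousOn P S) (hR : ContinuousOn R S) :
    ∃ (P' X X' : ℝ → A) (C : ℝ), ∀ s ∈ S,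
      HasDerivWithinAt P (P' s) S s ∧ HasDerivWithinAt X (X' s) S s ∧
      H s * X s - X s * H s = -P' s ∧ P s * X s * P s = 0 ∧ P s * X' s * P s = 0 ∧
      ‖X s‖ ≤ C ∧ ‖X' s‖ ≤ C := by
  set P' : ℝ → A := fun s => -(R s * D s * P s + P s * D s * R s) with hP'def
  set R' : ℝ → A := fun s =>
    (R s + P s) * (-D s + E' s • 1 - P' s) * (R s + P s) - P' s with hR'def
  set X : ℝ → A := fun s => R s * R s * D s * P s - P s * D s * R s * R s with hXdef
  set X' : ℝ → A := fun s =>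
    ((R' s * R s + R s * R' s) * D s + R s * R s * D' s) * P s + R s * R s * D s * P' s
      - (((P' s * D s + P s * D' s) * R s + P s * D s * R' s) * R s + P s * D s * R s * R' s)
    with hX'def
  have dP : ∀ s ∈ S, HasDerivWithinAt P (P' s) S s := fun s hs =>
    hasDerivWithinAt_proj hI hs (hH s hs) (hE s hs) (hP s hs) (hR s hs)
  have dR : ∀ s ∈ S, HasDerivWithinAt R (R' s) S s := fun s hs =>
    hasDerivWithinAt_resolvent hI hs (hH s hs) (hE s hs) (dP s hs) (hR s hs)
  have dX : ∀ s ∈ S, HasDerivWithinAt X (X' s) S s := fun s hs =>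
    ((((dR s hs).mul (dR s hs)).mul (hD s hs)).mul (dP s hs)).sub
      ((((dP s hs).mul (hD s hs)).mul (dR s hs)).mul (dR s hs))
  have hPR : ∀ s ∈ S, P' s * R s + P s * R' s = 0 := fun s hs =>
    (hSu s hs).eq_deriv _ ((dP s hs).mul (dR s hs))
      ((hasDerivWithinAt_const s S (0 : A)).congr (fun t ht => (hI t ht).proj_resolvent)
        (hI s hs).proj_resolvent)
  have hRP : ∀ s ∈ S, R' s * P s + R s * P' s = 0 := fun s hs =>
    (hSu s hs).eq_deriv _ ((dR s hs).mul (dP s hs))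
      ((hasDerivWithinAt_const s S (0 : A)).congr (fun t ht => (hI t ht).resolvent_proj)
        (hI s hs).resolvent_proj)
  have bdd : ∀ {F : ℝ → A}, ContinuousOn F S → F =O[𝓟 S] (fun _ => (1 : ℝ)) := fun hF =>
    hF.isBigO_principal hS (by simp)
  have bmul : ∀ {F G : ℝ → A}, F =O[𝓟 S] (fun _ => (1 : ℝ)) → G =O[𝓟 S] (fun _ => (1 : ℝ)) →
      (fun s => F s * G s) =O[𝓟 S] (fun _ => (1 : ℝ)) := fun hF hG => by
    simpa using hF.mul hG
  have bP := bdd hP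
  have bR := bdd hR
  have bD : D =O[𝓟 S] (fun _ => (1 : ℝ)) := bdd fun s hs => (hD s hs).continuousWithinAt
  have bD' := bdd hD'
  have bE' : (fun s => E' s • (1 : A)) =O[𝓟 S] (fun _ => (1 : ℝ)) := by
    have h1 : E' =O[𝓟 S] (fun _ => (1 : ℝ)) :=
      (IsBigO.of_bound 1 (eventually_principal.2 fun s hs => by simpa using hE' s hs)).trans bD
    simpa using h1.smul (isBigO_const_const (1 : A) (one_ne_zero (α := ℝ)) (𝓟 S))
  have bP' : P' =O[𝓟 S] (fun _ => (1 : ℝ)) :=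
    ((bmul (bmul bR bD) bP).add (bmul (bmul bP bD) bR)).neg_left
  have bR' : R' =O[𝓟 S] (fun _ => (1 : ℝ)) :=
    (bmul (bmul (bR.add bP) ((bD.neg_left.add bE').sub bP')) (bR.add bP)).sub bP'
  have bX' : X' =O[𝓟 S] (fun _ => (1 : ℝ)) :=
    ((bmul ((bmul ((bmul bR' bR).add (bmul bR bR')) bD).add (bmul (bmul bR bR) bD')) bP).add
      (bmul (bmul (bmul bR bR) bD) bP')).sub
    ((bmul ((bmul ((bmul bP' bD).add (bmul bP bD')) bR).add (bmul (bmul bP bD) bR')) bR).add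
      (bmul (bmul (bmul bP bD) bR) bR'))
  have bX : X =O[𝓟 S] (fun _ => (1 : ℝ)) :=
    (bmul (bmul (bmul bR bR) bD) bP).sub (bmul (bmul (bmul bP bD) bR) bR)
  obtain ⟨C₁, h₁⟩ := isBigO_principal.1 bX
  obtain ⟨C₂, h₂⟩ := isBigO_principal.1 bX'
  refine ⟨P', X, X', max C₁ C₂, fun s hs => ⟨dP s hs, dX s hs, ?_, ?_, ?_, ?_, ?_⟩⟩
  · rw [(hI s hs).commutator, hP'def, neg_neg]
  · exact (hI s hs).proj_mul_generator_mul_proj _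
  · exact (hI s hs).proj_mul_deriv_generator_mul_proj rfl (hPR s hs) (hRP s hs)
  · exact (by simpa using h₁ s hs : ‖X s‖ ≤ C₁).trans (le_max_left _ _)
  · exact (by simpa using h₂ s hs : ‖X' s‖ ≤ C₂).trans (le_max_right _ _)

end Deriv
end IsReducedResolvent

section Evolution

variable {V : Type*} [NormedAddCommGroup V] [InnerProductSpace ℂ V]

theorem HasDerivWithinAt.inner_clm_apply {B : ℝ → V →L[ℂ] V} {B' h : V →L[ℂ] V} {ψ : ℝ → V}
    {S : Set ℝ} {s τ : ℝ} (hh : (h : V →ₗ[ℂ] V).IsSymmetric) (hB : HasDerivWithinAt B B' S s)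
    (hψ : HasDerivWithinAt ψ ((-Complex.I * (τ : ℂ)) • h (ψ s)) S s) :
    HasDerivWithinAt (fun t => ⟪ψ t, B t (ψ t)⟫_ℂ)
      (Complex.I * τ * ⟪ψ s, (h * B s - B s * h) (ψ s)⟫_ℂ + ⟪ψ s, B' (ψ s)⟫_ℂ) S s := by
  have h1 : HasDerivWithinAt (fun t => B t (ψ t))
      (B' (ψ s) + B s ((-Complex.I * (τ : ℂ)) • h (ψ s))) S s :=
    ((ContinuousLinearMap.restrictScalarsL ℂ V V ℝ ℝ).hasFDerivAt.comp_hasDerivWithinAt s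
      hB).clm_apply hψ
  refine (hψ.inner ℂ h1).congr_deriv ?_
  have := hh (ψ s) (B s (ψ s))
  simp only [ContinuousLinearMap.coe_coe] at this
  simp only [inner_add_right, map_smul, inner_smul_right, inner_smul_left, map_mul, map_neg,
    Complex.conj_I, Complex.conj_ofReal, this, _root_.sub_apply, inner_sub_right,
    mul_apply_eq_comp]
  ring

theorem norm_inner_clm_apply_le {A p : V →L[ℂ] V} (hA : p * A * p = 0)
    (hp : (p : V →ₗ[ℂ] V).IsSymmetric) (v : V) (hpv : ‖p v‖ ≤ ‖v‖) :
    ‖⟪v, A v⟫_ℂ‖ ≤ 2 * ‖A‖ * ‖v‖ * ‖v - p v‖ := by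
  have h0 : ⟪p v, A (p v)⟫_ℂ = 0 := by
    have h1 := hp v (A (p v))
    have h2 : p (A (p v)) = 0 := by simpa using DFunLike.congr_fun hA v
    simp only [ContinuousLinearMap.coe_coe] at h1
    rw [h1, h2, inner_zero_right]
  have h1 : ⟪v, A v⟫_ℂ = ⟪v - p v, A v⟫_ℂ + ⟪p v, A (v - p v)⟫_ℂ := by
    rw [map_sub, inner_sub_right, inner_sub_left, h0]
    ring
  have h2 : ‖⟪v - p v, A v⟫_ℂ‖ ≤ ‖v - p v‖ * (‖A‖ * ‖v‖) :=
    (norm_inner_le_norm _ _).trans (by gcongr; exact A.le_opNorm v)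
  have h3 : ‖⟪p v, A (v - p v)⟫_ℂ‖ ≤ ‖v‖ * (‖A‖ * ‖v - p v‖) :=
    (norm_inner_le_norm _ _).trans (by gcongr; exact A.le_opNorm _)
  rw [h1]
  refine (norm_add_le _ _).trans ?_
  linarith

end Evolution

/-- `p` is the spectral projection of `h` onto its lowest eigenvalue `e`, and the rest of the
spectrum of `h` lies above `e + γ`. -/
structure IsGroundProjection {V : Type*} [NormedAddCommGroup V] [InnerProductSpace ℂ V]
    (h p : V →L[ℂ] V) (e γ : ℝ) : Prop where
  symm : (h : V →ₗ[ℂ] V).IsSymmetric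
  symm_proj : (p : V →ₗ[ℂ] V).IsSymmetric
  idem : p * p = p
  mul_proj : h * p = e • p
  ne_zero : p ≠ 0
  gap : ∀ v, γ * ‖v - p v‖ ^ 2 ≤ (⟪v, h v⟫_ℂ).re - e * ‖v‖ ^ 2

namespace IsGroundProjection

variable {V : Type*} [NormedAddCommGroup V] [InnerProductSpace ℂ V]

section

variable {h p h₁ p₁ : V →L[ℂ] V} {e γ e₁ : ℝ}

theorem apply_apply (G : IsGroundProjection h p e γ) (v : V) : p (p v) = p v :=
  DFunLike.congr_fun G.idem v

theorem apply_proj (G : IsGroundProjection h p e γ) (v : V) : h (p v) = e • p v :=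
  DFunLike.congr_fun G.mul_proj v

theorem inner_symm (G : IsGroundProjection h p e γ) (v w : V) : ⟪h v, w⟫_ℂ = ⟪v, h w⟫_ℂ :=
  G.symm v w

theorem inner_proj (G : IsGroundProjection h p e γ) (v w : V) : ⟪p v, w⟫_ℂ = ⟪v, p w⟫_ℂ :=
  G.symm_proj v w

theorem proj_mul (G : IsGroundProjection h p e γ) : p * h = e • p := by
  ext v
  refine ext_inner_right ℂ fun w => ?_
  simp only [mul_apply_eq_comp, _root_.smul_apply]
  rw [G.inner_proj, G.inner_symm, G.apply_proj, ← Complex.coe_smul, ← Complex.coe_smul,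
    inner_smul_left, inner_smul_right, G.inner_proj, Complex.conj_ofReal]

theorem exists_unit (G : IsGroundProjection h p e γ) : ∃ v, ‖v‖ = 1 ∧ p v = v := by
  obtain ⟨w, hw⟩ : ∃ w, p w ≠ 0 := by
    by_contra! hc
    exact G.ne_zero (ContinuousLinearMap.ext hc)
  refine ⟨((‖p w‖⁻¹ : ℝ) : ℂ) • p w, ?_, ?_⟩
  · rw [norm_smul, Complex.norm_real, norm_inv, norm_norm, inv_mul_cancel₀ (norm_ne_zero_iff.2 hw)]
  · rw [map_smul, G.apply_apply]

theorem re_inner_apply_of_proj_eq (G : IsGroundProjection h p e γ) {v : V} (hv : p v = v) :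
    (⟪v, h v⟫_ℂ).re = e * ‖v‖ ^ 2 := by
  have h1 : h v = e • v := by simpa [hv] using G.apply_proj v
  rw [h1, ← Complex.coe_smul, inner_smul_right, Complex.re_ofReal_mul]
  congr 1
  exact inner_self_eq_norm_sq (𝕜 := ℂ) v

theorem re_inner_sub_le (v : V) : (⟪v, h₁ v⟫_ℂ).re ≤ (⟪v, h v⟫_ℂ).re + ‖h₁ - h‖ * ‖v‖ ^ 2 := by
  have h1 : ‖⟪v, (h₁ - h) v⟫_ℂ‖ ≤ ‖v‖ * (‖h₁ - h‖ * ‖v‖) :=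
    (norm_inner_le_norm _ _).trans (by gcongr; exact (h₁ - h).le_opNorm v)
  have h2 := (Complex.re_le_norm _).trans h1
  rw [_root_.sub_apply, inner_sub_right, Complex.sub_re] at h2
  linarith

theorem energy_sub_le (G : IsGroundProjection h p e γ) (G₁ : IsGroundProjection h₁ p₁ e₁ γ)
    (hγ : 0 < γ) : e₁ - e ≤ ‖h₁ - h‖ := by
  obtain ⟨v, hv, hpv⟩ := G.exists_unit
  have h1 := G₁.gap v
  have h2 := G.re_inner_apply_of_proj_eq hpv
  have h3 := re_inner_sub_le (h := h) (h₁ := h₁) v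
  rw [hv] at h1 h2 h3
  have h4 : 0 ≤ γ * ‖v - p₁ v‖ ^ 2 := by positivity
  linarith

theorem abs_energy_sub_le (G : IsGroundProjection h p e γ) (G₁ : IsGroundProjection h₁ p₁ e₁ γ)
    (hγ : 0 < γ) : |e₁ - e| ≤ ‖h₁ - h‖ :=
  abs_sub_le_iff.2 ⟨G.energy_sub_le G₁ hγ, norm_sub_rev h₁ h ▸ G₁.energy_sub_le G hγ⟩

theorem norm_proj_apply_le (G : IsGroundProjection h p e γ) (v : V) : ‖p v‖ ≤ ‖v‖ := by
  have e3 : ‖p v‖ * ‖p v‖ ≤ ‖v‖ * ‖p v‖ := by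
    rw [← inner_self_eq_norm_mul_norm (𝕜 := ℂ), G.inner_proj, G.apply_apply]
    exact re_inner_le_norm _ _
  rcases (norm_nonneg (p v)).eq_or_lt' with h | h
  · rw [h]; positivity
  · exact le_of_mul_le_mul_right e3 h

theorem norm_sub_proj_sq_le (G : IsGroundProjection h p e γ) (G₁ : IsGroundProjection h₁ p₁ e₁ γ)
    (hγ : 0 < γ) {v : V} (hv : p v = v) :
    ‖v - p₁ v‖ ^ 2 ≤ 2 / γ * ‖h₁ - h‖ * ‖v‖ ^ 2 := by
  have h1 := G₁.gap v
  have h2 := G.re_inner_apply_of_proj_eq hv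
  have h3 := re_inner_sub_le (h := h) (h₁ := h₁) v
  have h4 := G₁.energy_sub_le G hγ
  rw [norm_sub_rev] at h4
  have h5 : (e - e₁) * ‖v‖ ^ 2 ≤ ‖h₁ - h‖ * ‖v‖ ^ 2 := by gcongr
  have h6 : γ * ‖v - p₁ v‖ ^ 2 ≤ 2 * ‖h₁ - h‖ * ‖v‖ ^ 2 := by linarith
  rw [div_mul_eq_mul_div, div_mul_eq_mul_div, le_div_iff₀ hγ, mul_comm]
  exact h6

theorem norm_one_sub_mul_le (G : IsGroundProjection h p e γ) (G₁ : IsGroundProjection h₁ p₁ e₁ γ)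
    (hγ : 0 < γ) : ‖(1 - p₁) * p‖ ≤ √(2 / γ * ‖h₁ - h‖) := by
  refine ContinuousLinearMap.opNorm_le_bound _ (Real.sqrt_nonneg _) fun v => ?_
  have h1 := G.norm_sub_proj_sq_le G₁ hγ (G.apply_apply v)
  have h2 := Real.le_sqrt_of_sq_le h1
  rw [Real.sqrt_mul (by positivity), Real.sqrt_sq (norm_nonneg _)] at h2
  exact h2.trans (by gcongr; exact G.norm_proj_apply_le v)

variable [CompleteSpace V]

theorem norm_proj_sub_le (G : IsGroundProjection h p e γ) (G₁ : IsGroundProjection h₁ p₁ e₁ γ)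
    (hγ : 0 < γ) : ‖p₁ - p‖ ≤ 2 * √(2 / γ * ‖h₁ - h‖) := by
  have h1 := G.norm_one_sub_mul_le G₁ hγ
  have h2 := G₁.norm_one_sub_mul_le G hγ
  rw [norm_sub_rev] at h2
  have s1 : star p = p := (ContinuousLinearMap.isSelfAdjoint_iff_isSymmetric.2 G.symm_proj).star_eq
  have s2 : star p₁ = p₁ :=
    (ContinuousLinearMap.isSelfAdjoint_iff_isSymmetric.2 G₁.symm_proj).star_eq
  have h3 : p₁ - p = (1 - p) * p₁ - star ((1 - p₁) * p) := by
    rw [star_mul, star_sub, star_one, s1, s2]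
    noncomm_ring
  rw [h3]
  refine (norm_sub_le _ _).trans ?_
  rw [norm_star]
  linarith

theorem isUnit_shift (G : IsGroundProjection h p e γ) (hγ : 0 < γ) :
    IsUnit (h - e • 1 + p) := by
  have hc : 0 < min γ 1 / 2 := by positivity
  refine ContinuousLinearMap.isUnit_of_forall_le_norm_inner_map _ (c := ⟨_, hc.le⟩) hc fun v => ?_
  have h1 : (⟪(h - e • 1 + p) v, v⟫_ℂ).re = (⟪v, h v⟫_ℂ).re - e * ‖v‖ ^ 2 + ‖p v‖ ^ 2 := by
    have e1 : ⟪p v, v⟫_ℂ = ⟪p v, p v⟫_ℂ := by rw [G.inner_proj v (p v), G.apply_apply, G.inner_proj]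
    have e2 : (h - e • 1 + p) v = h v - (e : ℂ) • v + p v := rfl
    rw [e2, inner_add_left, inner_sub_left, inner_smul_left, G.inner_symm, e1, Complex.conj_ofReal,
      Complex.add_re, Complex.sub_re, Complex.re_ofReal_mul]
    congr 1
    · congr 2
      exact inner_self_eq_norm_sq (𝕜 := ℂ) v
    · exact inner_self_eq_norm_sq (𝕜 := ℂ) (p v)
  have h2 := G.gap v
  have h3 : ‖v‖ ^ 2 ≤ 2 * (‖v - p v‖ ^ 2 + ‖p v‖ ^ 2) := by
    have e1 : ‖v‖ ≤ ‖v - p v‖ + ‖p v‖ := norm_le_norm_sub_add v (p v)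
    have e2 : ‖v‖ ^ 2 ≤ (‖v - p v‖ + ‖p v‖) ^ 2 := by gcongr
    nlinarith [sq_nonneg (‖v - p v‖ - ‖p v‖)]
  have h4 : min γ 1 * ‖v - p v‖ ^ 2 ≤ γ * ‖v - p v‖ ^ 2 := by gcongr; exact min_le_left _ _
  have h5 : min γ 1 * ‖p v‖ ^ 2 ≤ 1 * ‖p v‖ ^ 2 := by gcongr; exact min_le_right _ _
  have h6 : min γ 1 / 2 * ‖v‖ ^ 2 ≤ min γ 1 / 2 * (2 * (‖v - p v‖ ^ 2 + ‖p v‖ ^ 2)) := by gcongr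
  change ‖v‖ ^ 2 * (min γ 1 / 2) ≤ _
  refine le_trans ?_ (Complex.re_le_norm _)
  rw [h1]
  linarith

theorem isReducedResolvent (G : IsGroundProjection h p e γ) (hγ : 0 < γ) :
    IsReducedResolvent h p (Ring.inverse (h - e • 1 + p) - p) e := by
  have hT := G.isUnit_shift hγ
  set T := h - e • (1 : V →L[ℂ] V) + p with hTdef
  have hh : h = T + e • 1 - p := by rw [hTdef]; abel
  have hTp : T * p = p := by
    rw [hTdef, add_mul, sub_mul, G.mul_proj, G.idem, smul_mul_assoc, one_mul]; abel
  have hpT : p * T = p := by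
    rw [hTdef, mul_add, mul_sub, G.proj_mul, G.idem, mul_smul_comm, mul_one]; abel
  have hi1 := Ring.inverse_mul_cancel T hT
  have hi2 := Ring.mul_inverse_cancel T hT
  set U := Ring.inverse T
  have hUp : U * p = p := by
    calc U * p = U * (T * p) := by rw [hTp]
      _ = p := by rw [← mul_assoc, hi1, one_mul]
  have hpU : p * U = p := by
    calc p * U = p * T * U := by rw [hpT]
      _ = p := by rw [mul_assoc, hi2, mul_one]
  refine ⟨G.idem, G.mul_proj, G.proj_mul, ?_, ?_, ?_, ?_⟩
  · rw [sub_mul, hUp, G.idem, sub_self]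
  · rw [mul_sub, hpU, G.idem, sub_self]
  · rw [hh]
    simp only [mul_add, sub_mul, mul_sub, mul_smul_comm, mul_one, hi1, hpT, hUp, G.idem]
    module
  · rw [hh]
    simp only [add_mul, sub_mul, mul_sub, smul_mul_assoc, one_mul, hi2, hTp, hpU, G.idem]
    module

end

section Family

variable {H P : ℝ → V →L[ℂ] V} {E : ℝ → ℝ} {γ : ℝ} {S : Set ℝ}

theorem continuousWithinAt_energy (hG : ∀ s ∈ S, IsGroundProjection (H s) (P s) (E s) γ)
    (hγ : 0 < γ) {s : ℝ} (hs : s ∈ S) (hH : ContinuousWithinAt H S s) :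
    ContinuousWithinAt E S s := by
  refine tendsto_iff_norm_sub_tendsto_zero.2 (squeeze_zero' (.of_forall fun _ => norm_nonneg _)
    (eventually_nhdsWithin_of_forall fun t ht => (hG s hs).abs_energy_sub_le (hG t ht) hγ)
    (tendsto_iff_norm_sub_tendsto_zero.1 hH))

variable [CompleteSpace V]

theorem continuousWithinAt_proj (hG : ∀ s ∈ S, IsGroundProjection (H s) (P s) (E s) γ)
    (hγ : 0 < γ) {s : ℝ} (hs : s ∈ S) (hH : ContinuousWithinAt H S s) :
    ContinuousWithinAt P S s := by
  refine tendsto_iff_norm_sub_tendsto_zero.2 (squeeze_zero' (.of_forall fun _ => norm_nonneg _)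
    (eventually_nhdsWithin_of_forall fun t ht => (hG s hs).norm_proj_sub_le (hG t ht) hγ) ?_)
  have h1 := (((tendsto_iff_norm_sub_tendsto_zero.1 hH).const_mul (2 / γ)).sqrt).const_mul 2
  simpa using h1

theorem continuousWithinAt_resolvent (hG : ∀ s ∈ S, IsGroundProjection (H s) (P s) (E s) γ)
    (hγ : 0 < γ) {s : ℝ} (hs : s ∈ S) (hH : ContinuousWithinAt H S s) :
    ContinuousWithinAt (fun t => Ring.inverse (H t - E t • 1 + P t) - P t) S s := by
  have hP := continuousWithinAt_proj hG hγ hs hH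
  have hT : ContinuousWithinAt (fun t => H t - E t • (1 : V →L[ℂ] V) + P t) S s :=
    (hH.sub ((continuousWithinAt_energy hG hγ hs hH).smul continuousWithinAt_const)).add hP
  obtain ⟨u, hu⟩ := (hG s hs).isUnit_shift hγ
  have hinv := NormedRing.inverse_continuousAt u
  rw [hu] at hinv
  exact (hinv.comp_continuousWithinAt (f := fun t => H t - E t • (1 : V →L[ℂ] V) + P t) hT).sub hP

theorem exists_hasDerivWithinAt_energy
    (hG : ∀ s ∈ S, IsGroundProjection (H s) (P s) (E s) γ) (hγ : 0 < γ) {s : ℝ} (hs : s ∈ S)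
    {d : V →L[ℂ] V} (hH : HasDerivWithinAt H d S s) :
    ∃ e', HasDerivWithinAt E e' S s ∧ ‖e'‖ ≤ ‖d‖ := by
  obtain ⟨v, hv, hpv⟩ := (hG s hs).exists_unit
  have hP := continuousWithinAt_proj hG hγ hs hH.continuousWithinAt
  have h1 : HasDerivWithinAt (fun t => 1 * (H t - H s) * P t) (1 * d * P s) S s :=
    HasDerivWithinAt.mul_mul_of_eq_zero continuousWithinAt_const (hH.sub_const _) (by simp) hP
  have h2 : HasDerivWithinAt (fun t => (⟪v, (1 * (H t - H s) * P t) v⟫_ℂ).re)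
      (⟪v, d v⟫_ℂ).re S s := by
    have h3 := ((ContinuousLinearMap.restrictScalarsL ℂ V V ℝ ℝ).hasFDerivAt.comp_hasDerivWithinAt s
      h1).clm_apply (hasDerivWithinAt_const s S v)
    have h4 := (hasDerivWithinAt_const s S v).inner ℂ h3
    refine (Complex.reCLM.hasFDerivAt.comp_hasDerivWithinAt s h4).congr_deriv ?_
    simp [hpv]
  have hb : ContinuousWithinAt (fun t => (⟪v, P t v⟫_ℂ).re) S s :=
    Complex.continuous_re.continuousAt.comp_continuousWithinAt
      (ContinuousWithinAt.inner (𝕜 := ℂ) continuousWithinAt_const (hP.clm_apply continuousWithinAt_const))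
  have hbs : (⟪v, P s v⟫_ℂ).re = 1 := by
    rw [hpv]
    have := inner_self_eq_norm_sq (𝕜 := ℂ) v
    rw [hv, one_pow] at this
    exact this
  have h5 : HasDerivWithinAt
      (fun t => 1 * (⟪v, (1 * (H t - H s) * P t) v⟫_ℂ).re * (⟪v, P t v⟫_ℂ).re⁻¹)
      (1 * (⟪v, d v⟫_ℂ).re * (⟪v, P s v⟫_ℂ).re⁻¹) S s :=
    HasDerivWithinAt.mul_mul_of_eq_zero continuousWithinAt_const h2 (by simp)
      (hb.inv₀ (by rw [hbs]; exact one_ne_zero))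
  have hkey : ∀ t ∈ S, (⟪v, (1 * (H t - H s) * P t) v⟫_ℂ).re
      = (E t - E s) * (⟪v, P t v⟫_ℂ).re := by
    intro t ht
    have e1 : (1 * (H t - H s) * P t) v = (E t : ℂ) • P t v - H s (P t v) := by
      rw [one_mul, mul_apply_eq_comp, _root_.sub_apply, (hG t ht).apply_proj]; rfl
    have e2 : H s v = (E s : ℂ) • v := by simpa [hpv] using (hG s hs).apply_proj v
    rw [e1, inner_sub_right, ← (hG s hs).inner_symm, e2, inner_smul_left, inner_smul_right,
      Complex.conj_ofReal, ← sub_mul, ← Complex.ofReal_sub, Complex.re_ofReal_mul]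
  have hev : ∀ᶠ t in 𝓝[S] s, (⟪v, P t v⟫_ℂ).re ≠ 0 :=
    hb.eventually_ne (by simp [hbs])
  refine ⟨(⟪v, d v⟫_ℂ).re, ?_, ?_⟩
  · refine ((h5.const_add (E s)).congr_of_eventuallyEq ?_ ?_).congr_deriv ?_
    · filter_upwards [hev, self_mem_nhdsWithin] with t ht hts
      rw [hkey t hts, one_mul, mul_assoc, mul_inv_cancel₀ ht]
      ring
    · simp
    · rw [hbs]; simp
  · refine (Complex.abs_re_le_norm _).trans ((norm_inner_le_norm _ _).trans ?_)
    simpa [hv] using d.le_opNorm v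

end Family

end IsGroundProjection

/-- The transition estimate, given a generator `X` of the motion of the spectral projection. -/
theorem IsGroundProjection.norm_sub_proj_le_of_generator {V : Type*} [NormedAddCommGroup V]
    [InnerProductSpace ℂ V] [CompleteSpace V] {H P P' X X' : ℝ → V →L[ℂ] V} {E : ℝ → ℝ} {γ C : ℝ}
    (hG : ∀ s ∈ Icc (0 : ℝ) 1, IsGroundProjection (H s) (P s) (E s) γ)
    (hX : ∀ s ∈ Icc (0 : ℝ) 1,
      HasDerivWithinAt P (P' s) (Icc 0 1) s ∧ HasDerivWithinAt X (X' s) (Icc 0 1) s ∧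
      H s * X s - X s * H s = -P' s ∧ P s * X s * P s = 0 ∧ P s * X' s * P s = 0 ∧
      ‖X s‖ ≤ C ∧ ‖X' s‖ ≤ C) {τ : ℝ} (hτ : 0 < τ) {ψ : ℝ → V}
    (hψ : ∀ s ∈ Icc (0 : ℝ) 1,
      HasDerivWithinAt ψ ((-Complex.I * (τ : ℂ)) • H s (ψ s)) (Icc 0 1) s)
    (hψP : P 0 (ψ 0) = ψ 0) (hψ0 : ‖ψ 0‖ = 1) :
    ∀ s ∈ Icc (0 : ℝ) 1, ‖ψ s - P s (ψ s)‖ ≤ 4 * C / τ := by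
  have h0 : (0 : ℝ) ∈ Icc (0 : ℝ) 1 := by simp
  have hC : 0 ≤ C := (norm_nonneg _).trans (hX 0 h0).2.2.2.2.2.1
  have hnorm : ∀ s ∈ Icc (0 : ℝ) 1, ‖ψ s‖ = 1 := by
    intro s hs
    have := (convex_Icc (0 : ℝ) 1).norm_image_sub_le_of_norm_hasDerivWithin_le (C := 0)
      (fun s hs => HasDerivWithinAt.inner_clm_apply (hG s hs).symm
        (hasDerivWithinAt_const s (Icc (0 : ℝ) 1) (1 : V →L[ℂ] V)) (hψ s hs))
      (fun s hs => by simp) h0 hs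
    rw [zero_mul, norm_le_zero_iff, sub_eq_zero] at this
    simp only [one_apply_eq_self, inner_self_eq_norm_sq_to_K, hψ0] at this
    have h2 : ‖ψ s‖ ^ 2 = 1 ^ 2 := by exact_mod_cast this
    exact (pow_left_inj₀ (norm_nonneg _) zero_le_one two_ne_zero).1 h2
  have hsq : ∀ s ∈ Icc (0 : ℝ) 1, ⟪ψ s, (1 - P s) (ψ s)⟫_ℂ = (‖ψ s - P s (ψ s)‖ ^ 2 : ℝ) := by
    intro s hs
    have e1 : ⟪P s (ψ s), ψ s - P s (ψ s)⟫_ℂ = 0 := by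
      rw [(hG s hs).inner_proj, map_sub, (hG s hs).apply_apply, sub_self, inner_zero_right]
    have e3 : ⟪ψ s - P s (ψ s), ψ s - P s (ψ s)⟫_ℂ = ⟪ψ s, ψ s - P s (ψ s)⟫_ℂ := by
      rw [inner_sub_left, e1, sub_zero]
    rw [inner_self_eq_norm_sq_to_K] at e3
    simpa using e3.symm
  have hcont : ContinuousOn (fun s => ‖ψ s - P s (ψ s)‖) (Icc 0 1) := by
    intro s hs
    exact ((hψ s hs).continuousWithinAt.sub
      ((hX s hs).1.continuousWithinAt.clm_apply (hψ s hs).continuousWithinAt)).norm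
  obtain ⟨m, hm, hmax⟩ := isCompact_Icc.exists_isMaxOn ⟨0, h0⟩ hcont
  set M := ‖ψ m - P m (ψ m)‖ with hM
  have hmax' : ∀ s ∈ Icc (0 : ℝ) 1, ‖ψ s - P s (ψ s)‖ ≤ M := fun s hs => hmax hs
  have hquad : ∀ {A : V →L[ℂ] V}, ∀ s ∈ Icc (0 : ℝ) 1, P s * A * P s = 0 → ‖A‖ ≤ C →
      ‖⟪ψ s, A (ψ s)⟫_ℂ‖ ≤ 2 * C * ‖ψ s - P s (ψ s)‖ := by
    intro A s hs hA hAC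
    refine (norm_inner_clm_apply_le hA (hG s hs).symm_proj _ ((hG s hs).norm_proj_apply_le _)).trans ?_
    rw [hnorm s hs, mul_one]
    gcongr
  have hτC : (Complex.I * (τ : ℂ)) ≠ 0 := by simp [hτ.ne']
  have hmvt := (convex_Icc (0 : ℝ) 1).norm_image_sub_le_of_norm_hasDerivWithin_le
      (C := 2 * C * M / τ)
      (f := fun t => ⟪ψ t, (1 - P t) (ψ t)⟫_ℂ - (Complex.I * τ)⁻¹ * ⟪ψ t, X t (ψ t)⟫_ℂ)
      (f' := fun t => -((Complex.I * τ)⁻¹ * ⟪ψ t, X' t (ψ t)⟫_ℂ))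
      (fun s hs => by
        refine ((HasDerivWithinAt.inner_clm_apply (hG s hs).symm ((hX s hs).1.const_sub 1)
          (hψ s hs)).sub ((HasDerivWithinAt.inner_clm_apply (hG s hs).symm (hX s hs).2.1
          (hψ s hs)).const_mul (Complex.I * (τ : ℂ))⁻¹)).congr_deriv ?_
        have e1 : H s * (1 - P s) - (1 - P s) * H s = 0 := by
          rw [mul_sub, sub_mul, (hG s hs).mul_proj, (hG s hs).proj_mul]; simp
        rw [e1, (hX s hs).2.2.1, mul_add, inv_mul_cancel_left₀ hτC]
        simp)
      (fun s hs => by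
        have e1 := hquad s hs (hX s hs).2.2.2.2.1 (hX s hs).2.2.2.2.2.2
        rw [norm_neg, norm_mul, norm_inv, norm_mul, Complex.norm_I, one_mul, Complex.norm_real,
          Real.norm_of_nonneg hτ.le, inv_mul_eq_div]
        gcongr
        exact e1.trans (by gcongr; exact hmax' s hs)) h0 hm
  have hX0 : ⟪ψ 0, X 0 (ψ 0)⟫_ℂ = 0 := by
    have := hquad 0 h0 (hX 0 h0).2.2.2.1 (hX 0 h0).2.2.2.2.2.1
    rw [hψP, sub_self, norm_zero, mul_zero, norm_le_zero_iff] at this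
    exact this
  have hf0 : ⟪ψ 0, (1 - P 0) (ψ 0)⟫_ℂ = 0 := by simp [hψP]
  rw [hX0, hf0, hsq m hm, mul_zero, sub_zero, sub_zero, ← hM] at hmvt
  have hXm : ‖(Complex.I * (τ : ℂ))⁻¹ * ⟪ψ m, X m (ψ m)⟫_ℂ‖ ≤ 2 * C * M / τ := by
    have e1 := hquad m hm (hX m hm).2.2.2.1 (hX m hm).2.2.2.2.2.1
    rw [norm_mul, norm_inv, norm_mul, Complex.norm_I, one_mul, Complex.norm_real,
      Real.norm_of_nonneg hτ.le, inv_mul_eq_div]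
    gcongr
  have hm1 : ‖m - 0‖ ≤ 1 := by
    rw [sub_zero, Real.norm_of_nonneg hm.1]; exact hm.2
  have hMM : M * M ≤ 4 * C / τ * M := by
    have e1 : ‖((M ^ 2 : ℝ) : ℂ)‖ = M * M := by
      rw [Complex.norm_real, Real.norm_of_nonneg (by positivity)]; ring
    have e2 := norm_le_norm_sub_add ((M ^ 2 : ℝ) : ℂ)
      ((Complex.I * (τ : ℂ))⁻¹ * ⟪ψ m, X m (ψ m)⟫_ℂ)
    rw [e1] at e2
    have e3 : 2 * C * M / τ * ‖m - 0‖ ≤ 2 * C * M / τ := mul_le_of_le_one_right (by positivity) hm1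
    have e4 : 4 * C / τ * M = 2 * C * M / τ + 2 * C * M / τ := by ring
    linarith
  have hMle : M ≤ 4 * C / τ := by
    rcases (norm_nonneg (ψ m - P m (ψ m))).eq_or_lt' with h | h
    · rw [hM, h]; positivity
    · exact le_of_mul_le_mul_right hMM h
  exact fun s hs => (hmax' s hs).trans hMle

/-- The adiabatic theorem for a norm-`C²` family of bounded self-adjoint operators. -/
theorem exists_forall_norm_sub_proj_le {V : Type*} [NormedAddCommGroup V]
    [InnerProductSpace ℂ V] [CompleteSpace V] {H D D' P : ℝ → V →L[ℂ] V} {E : ℝ → ℝ} {γ : ℝ}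
    (hγ : 0 < γ) (hG : ∀ s ∈ Icc (0 : ℝ) 1, IsGroundProjection (H s) (P s) (E s) γ)
    (hH : ∀ s ∈ Icc (0 : ℝ) 1, HasDerivWithinAt H (D s) (Icc 0 1) s)
    (hD : ∀ s ∈ Icc (0 : ℝ) 1, HasDerivWithinAt D (D' s) (Icc 0 1) s)
    (hD' : ContinuousOn D' (Icc 0 1)) :
    ∃ C : ℝ, ∀ τ : ℝ, 0 < τ → ∀ ψ : ℝ → V,
      (∀ s ∈ Icc (0 : ℝ) 1,
        HasDerivWithinAt ψ ((-Complex.I * (τ : ℂ)) • H s (ψ s)) (Icc 0 1) s) →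
      P 0 (ψ 0) = ψ 0 → ‖ψ 0‖ = 1 →
      ∀ s ∈ Icc (0 : ℝ) 1, ‖ψ s - P s (ψ s)‖ ≤ C / τ := by
  choose! E' hE hE' using fun s hs =>
    IsGroundProjection.exists_hasDerivWithinAt_energy hG hγ hs (hH s hs)
  obtain ⟨P', X, X', C, hX⟩ := IsReducedResolvent.exists_generator
    (fun s hs => (hG s hs).isReducedResolvent hγ) isCompact_Icc (uniqueDiffOn_Icc zero_lt_one)
    hH hD hD' hE hE'
    (fun s hs => IsGroundProjection.continuousWithinAt_proj hG hγ hs (hH s hs).continuousWithinAt)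
    (fun s hs =>
      IsGroundProjection.continuousWithinAt_resolvent hG hγ hs (hH s hs).continuousWithinAt)
  exact ⟨4 * C, fun τ hτ ψ hψ hψP hψ0 =>
    IsGroundProjection.norm_sub_proj_le_of_generator hG hX hτ hψ hψP hψ0⟩

section Matrix

theorem ContDiffOn.exists_second_deriv {f : ℝ → ℂ} {S : Set ℝ} (hS : UniqueDiffOn ℝ S)
    (hf : ContDiffOn ℝ 2 f S) :
    ∃ f' f'' : ℝ → ℂ, (∀ s ∈ S, HasDerivWithinAt f (f' s) S s) ∧
      (∀ s ∈ S, HasDerivWithinAt f' (f'' s) S s) ∧ ContinuousOn f'' S := by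
  have h1 : ContDiffOn ℝ 1 (derivWithin f S) S := hf.derivWithin hS (by norm_num)
  refine ⟨derivWithin f S, derivWithin (derivWithin f S) S, fun s hs => ?_, fun s hs => ?_, ?_⟩
  · exact (hf.differentiableOn two_ne_zero s hs).hasDerivWithinAt
  · exact (h1.differentiableOn one_ne_zero s hs).hasDerivWithinAt
  · exact h1.continuousOn_derivWithin hS le_rfl

variable {n : Type*} [Fintype n] [DecidableEq n]

theorem Matrix.map_eq_sum_smul_single {F G : Type*} [AddCommGroup F] [Module ℂ F]
    [FunLike G (Matrix n n ℂ) F] [LinearMapClass G ℂ (Matrix n n ℂ) F] (L : G)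
    (M : Matrix n n ℂ) : L M = ∑ i, ∑ j, M i j • L (single i j 1) := by
  conv_lhs => rw [matrix_eq_sum_single M]
  simp only [map_sum, ← map_smul, smul_single, smul_eq_mul, mul_one]

theorem Matrix.hasDerivWithinAt_map {F G : Type*} [NormedAddCommGroup F] [NormedSpace ℂ F]
    [FunLike G (Matrix n n ℂ) F] [LinearMapClass G ℂ (Matrix n n ℂ) F] (L : G)
    {M : ℝ → Matrix n n ℂ} {M' : Matrix n n ℂ} {S : Set ℝ} {s : ℝ}
    (h : ∀ i j, HasDerivWithinAt (fun t => M t i j) (M' i j) S s) :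
    HasDerivWithinAt (fun t => L (M t)) (L M') S s := by
  simp only [map_eq_sum_smul_single L (M _), map_eq_sum_smul_single L M']
  exact HasDerivWithinAt.fun_sum fun i _ => HasDerivWithinAt.fun_sum fun j _ =>
    (h i j).smul_const _

theorem Matrix.continuousOn_map {F G : Type*} [NormedAddCommGroup F] [NormedSpace ℂ F]
    [FunLike G (Matrix n n ℂ) F] [LinearMapClass G ℂ (Matrix n n ℂ) F] (L : G)
    {M : ℝ → Matrix n n ℂ} {S : Set ℝ} (h : ∀ i j, ContinuousOn (fun t => M t i j) S) :
    ContinuousOn (fun t => L (M t)) S := by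
  simp only [map_eq_sum_smul_single L (M _)]
  exact continuousOn_finsetSum _ fun i _ => continuousOn_finsetSum _ fun j _ =>
    (h i j).smul continuousOn_const

theorem Matrix.isSymmetric_toEuclideanCLM {M : Matrix n n ℂ} (hM : M.IsHermitian) :
    (toEuclideanCLM (n := n) (𝕜 := ℂ) M : EuclideanSpace ℂ n →ₗ[ℂ] _).IsSymmetric := by
  rw [coe_toEuclideanCLM_eq_toEuclideanLin]
  exact isSymmetric_toEuclideanLin_iff.2 hM

theorem Matrix.isGroundProjection_toEuclideanCLM {H P : Matrix n n ℂ} {e γ : ℝ}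
    (hH : H.IsHermitian) (hP : P.IsHermitian) (hPP : P * P = P)
    (hrange : ∀ ψ, H *ᵥ ψ = (e : ℂ) • ψ ↔ P *ᵥ ψ = ψ) (he : e ∈ eigSet H)
    (hgap : ∀ μ ∈ eigSet H, μ ≠ e → e + γ ≤ μ) :
    IsGroundProjection (toEuclideanCLM (n := n) (𝕜 := ℂ) H)
      (toEuclideanCLM (n := n) (𝕜 := ℂ) P) e γ := by
  have hHP : H * P = (e : ℂ) • P := by
    refine Matrix.ext_of_mulVec_single fun i => ?_
    rw [← mulVec_mulVec, (hrange _).2 (by rw [mulVec_mulVec, hPP]), smul_mulVec]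
  have hPH : P * H = (e : ℂ) • P := by
    have := congrArg conjTranspose hHP
    rwa [conjTranspose_mul, conjTranspose_smul, hP.eq, hH.eq, Complex.star_def,
      Complex.conj_ofReal] at this
  set M : Matrix n n ℂ := H - (e : ℂ) • 1 - (γ : ℂ) • (1 - P) with hMdef
  have hM : M.IsHermitian := by
    rw [IsHermitian, hMdef]
    simp [conjTranspose_sub, conjTranspose_smul, hP.eq, hH.eq]
  have hPM : P * M = 0 := by
    rw [hMdef, mul_sub, mul_sub, hPH, mul_smul_comm, mul_smul_comm, mul_sub, hPP]
    simp
  have hMpos : M.PosSemidef := by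
    refine hM.posSemidef_iff_eigenvalues_nonneg.2 fun i => ?_
    set l := hM.eigenvalues i
    set w : n → ℂ := ⇑(hM.eigenvectorBasis i)
    have hw0 : w ≠ 0 := fun h0 => by
      have := hM.eigenvectorBasis.orthonormal.ne_zero i
      exact this (by ext k; exact congrFun h0 k)
    have hMw : M *ᵥ w = (l : ℂ) • w := hM.mulVec_eigenvectorBasis i
    have hPw : (l : ℂ) • P *ᵥ w = 0 := by
      rw [← mulVec_smul, ← hMw, mulVec_mulVec, hPM, zero_mulVec]
    change 0 ≤ l
    rcases smul_eq_zero.1 hPw with h0 | h0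
    · exact (Complex.ofReal_eq_zero.1 h0).ge
    · have hHw : H *ᵥ w = ((e + γ + l : ℝ) : ℂ) • w := by
        have : H = M + (e : ℂ) • 1 + (γ : ℂ) • (1 - P) := by rw [hMdef]; abel
        rw [this]
        simp only [add_mulVec, smul_mulVec, sub_mulVec, one_mulVec, hMw, h0]
        push_cast
        module
      have hne : e + γ + l ≠ e := fun h1 => by
        rw [h1, hrange, h0] at hHw
        exact hw0 hHw.symm
      linarith [hgap _ ⟨w, hw0, hHw⟩ hne]
  refine ⟨isSymmetric_toEuclideanCLM hH, isSymmetric_toEuclideanCLM hP, ?_, ?_, ?_, fun v => ?_⟩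
  · rw [← map_mul, hPP]
  · rw [← map_mul, hHP, map_smul]; rfl
  · obtain ⟨w, hw0, hw⟩ := he
    intro h0
    have hP0 : P = 0 := by simpa using h0
    rw [hrange, hP0, zero_mulVec] at hw
    exact hw0 hw.symm
  · have h1 := (isPositive_toEuclideanLin_iff.2 hMpos).re_inner_nonneg_right v
    set p := toEuclideanCLM (n := n) (𝕜 := ℂ) P with hp
    have h2 : toEuclideanLin M v
        = toEuclideanCLM (n := n) (𝕜 := ℂ) H v - (e : ℂ) • v - (γ : ℂ) • (v - p v) := by
      rw [← coe_toEuclideanCLM_eq_toEuclideanLin, hMdef, map_sub, map_sub, map_smul, map_smul,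
        map_sub, map_one]
      rfl
    have hpp : p (p v) = p v := by
      change (p * p) v = p v
      rw [hp, ← map_mul, hPP]
    have h3 : ⟪v, v - p v⟫_ℂ = ⟪v - p v, v - p v⟫_ℂ := by
      have h4 : ⟪p v, v - p v⟫_ℂ = ⟪v, p (v - p v)⟫_ℂ := isSymmetric_toEuclideanCLM hP v (v - p v)
      rw [inner_sub_left v, h4, map_sub, hpp, sub_self, inner_zero_right, sub_zero]
    rw [h2, inner_sub_right, inner_sub_right, inner_smul_right, inner_smul_right, h3,
      map_sub, map_sub, ← Complex.coe_algebraMap, RCLike.algebraMap_eq_ofReal,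
      RCLike.re_ofReal_mul, RCLike.re_ofReal_mul, inner_self_eq_norm_sq,
      inner_self_eq_norm_sq, RCLike.re_eq_complex_re] at h1
    linarith

end Matrix

theorem vnorm_eq_norm_toLp {n : ℕ} (v : Fin n → ℂ) : vnorm v = ‖WithLp.toLp 2 v‖ := by
  rw [vnorm, EuclideanSpace.norm_eq, dotProduct, Complex.re_sum]
  congr 1
  refine Finset.sum_congr rfl fun i _ => ?_
  rw [Pi.star_apply, Complex.star_def, ← Complex.normSq_eq_conj_mul_self, Complex.ofReal_re,
    Complex.normSq_eq_norm_sq]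

/-- Adiabatic Theorem: for a twice continuously differentiable family of
Hermitian matrices `H(s)`, `s ∈ [0,1]`, whose lowest-eigenvalue spectral projection
`P(s)` has constant rank and whose spectral gap is bounded below by `γ₀ > 0`, there is a
constant `C` such that every solution of `i ψ′(s) = τ H(s) ψ(s)` starting in a
normalized ground state satisfies `‖(1 − P(s)) ψ(s)‖ ≤ C/τ` for all `s ∈ [0,1]`. -/
theorem adiabatic_theorem
    (n : ℕ) (hn : 1 ≤ n)
    (H : ℝ → Matrix (Fin n) (Fin n) ℂ)
    (hsmooth : ∀ i j : Fin n, ContDiffOn ℝ 2 (fun s => H s i j) (Set.Icc 0 1))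
    (hherm : ∀ s ∈ Set.Icc (0 : ℝ) 1, (H s).IsHermitian)
    (E : ℝ → ℝ)
    (hE : ∀ s ∈ Set.Icc (0 : ℝ) 1, IsLeast (eigSet (H s)) (E s))
    (P : ℝ → Matrix (Fin n) (Fin n) ℂ)
    (hPherm : ∀ s ∈ Set.Icc (0 : ℝ) 1, (P s).IsHermitian)
    (hPproj : ∀ s ∈ Set.Icc (0 : ℝ) 1, P s * P s = P s)
    (hPrange : ∀ s ∈ Set.Icc (0 : ℝ) 1, ∀ ψ : Fin n → ℂ,
      (H s).mulVec ψ = ((E s : ℝ) : ℂ) • ψ ↔ (P s).mulVec ψ = ψ)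
    (hPrank : ∀ s ∈ Set.Icc (0 : ℝ) 1, ∀ t ∈ Set.Icc (0 : ℝ) 1, (P s).rank = (P t).rank)
    (γ₀ : ℝ) (hγ₀ : 0 < γ₀)
    (hgap : ∀ s ∈ Set.Icc (0 : ℝ) 1, ∀ μ ∈ eigSet (H s), μ ≠ E s → E s + γ₀ ≤ μ) :
    ∃ C : ℝ, ∀ τ : ℝ, 0 < τ →
      ∀ ψ : ℝ → (Fin n → ℂ),
        (∀ s ∈ Set.Icc (0 : ℝ) 1,
          HasDerivWithinAt ψ ((-Complex.I * (τ : ℂ)) • (H s).mulVec (ψ s))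
            (Set.Icc 0 1) s) →
        (P 0).mulVec (ψ 0) = ψ 0 →
        vnorm (ψ 0) = 1 →
        ∀ s ∈ Set.Icc (0 : ℝ) 1,
          vnorm (ψ s - (P s).mulVec (ψ s)) ≤ C / τ := by
  choose! D D' hD hD' hD'c using fun i j =>
    (hsmooth i j).exists_second_deriv (uniqueDiffOn_Icc zero_lt_one)
  let L := toEuclideanCLM (n := Fin n) (𝕜 := ℂ)
  obtain ⟨C, hC⟩ := exists_forall_norm_sub_proj_le (H := fun s => L (H s))
    (D := fun s => L (of fun i j => D i j s)) (D' := fun s => L (of fun i j => D' i j s))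
    (P := fun s => L (P s)) hγ₀
    (fun s hs => isGroundProjection_toEuclideanCLM (hherm s hs) (hPherm s hs)
      (hPproj s hs) (hPrange s hs) (hE s hs).1 (hgap s hs))
    (fun s hs => hasDerivWithinAt_map L fun i j => hD i j s hs)
    (fun s hs => hasDerivWithinAt_map L fun i j => hD' i j s hs)
    (continuousOn_map L fun i j => hD'c i j)
  refine ⟨C, fun τ hτ ψ hψ hψP hψ0 s hs => ?_⟩
  have hsol : ∀ t ∈ Set.Icc (0 : ℝ) 1, HasDerivWithinAt (fun r => WithLp.toLp 2 (ψ r))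
      ((-Complex.I * (τ : ℂ)) • L (H t) (WithLp.toLp 2 (ψ t))) (Set.Icc 0 1) t := fun t ht =>
    ((EuclideanSpace.equiv (Fin n) ℂ).symm.toContinuousLinearMap.restrictScalars
      ℝ).hasFDerivAt.comp_hasDerivWithinAt t (hψ t ht)
  rw [vnorm_eq_norm_toLp] at hψ0 ⊢
  exact hC τ hτ _ hsol (congrArg (WithLp.toLp 2) hψP) hψ0 s hs
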